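/- Let n ≥ 3 be an integer and λ₁ > 0. There exists a constant C > 1 depending only on n such that for every λ ≥ λ₁ and every z > (n/(4λ₁))^{1/n}: C^{-1} · λ^{1/4}·z^{(n−2)/4} · e^{−(2/√n)·√λ·z^{n/2}} < −D'(z) < C · λ^{1/4}·z^{(n−2)/4} · e^{−(2/√n)·√λ·z^{n/2}}, and C^{-1} · λ^{1/4}·z^{(n−2)/4} · e^{(2/√n)·√λ·z^{n/2}} < G'(z) < C · λ^{1/4}·z^{(n−2)/4} · e^{(2/√n)·√λ·z^{n/2}}, where D' and G' denote the derivatives in z. -/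

import Mathlib

/-- The modified Bessel function of the second kind,
`K_ν(y) = ∫_0^∞ e^{-y·cosh t} · cosh(ν t) dt`. -/
noncomputable def besselK (ν y : ℝ) : ℝ :=
  ∫ t in Set.Ioi (0:ℝ), Real.exp (-y * Real.cosh t) * Real.cosh (ν * t)

/-- The modified Bessel function of the first kind,
`I_ν(y) = (1/π)∫_0^π e^{y·cos θ}·cos(νθ) dθ − (sin(νπ)/π)∫_0^∞ e^{-y·cosh t − νt} dt`. -/
noncomputable def besselI (ν y : ℝ) : ℝ :=
  (1 / Real.pi) * ∫ θ in (0:ℝ)..Real.pi, Real.exp (y * Real.cos θ) * Real.cos (ν * θ)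
    - (Real.sin (ν * Real.pi) / Real.pi) *
      ∫ t in Set.Ioi (0:ℝ), Real.exp (-y * Real.cosh t - ν * t)

/-- The decaying solution `D(z) = √z · K_{1/n}(2·√(λ/n)·z^{n/2})`. -/
noncomputable def calD (n : ℕ) (lam z : ℝ) : ℝ :=
  Real.sqrt z * besselK (1 / (n : ℝ)) (2 * Real.sqrt (lam / n) * z ^ ((n : ℝ) / 2))

/-- The growing solution `G(z) = √z · I_{1/n}(2·√(λ/n)·z^{n/2})`. -/
noncomputable def calG (n : ℕ) (lam z : ℝ) : ℝ :=
  Real.sqrt z * besselI (1 / (n : ℝ)) (2 * Real.sqrt (lam / n) * z ^ ((n : ℝ) / 2))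

open MeasureTheory Set Filter Topology

/-- The exponential integral `∫_0^∞ e^{-y·cosh t + a·t} dt`, out of which both Bessel functions
are built. -/
noncomputable def coshExpIntegral (a y : ℝ) : ℝ :=
  ∫ t in Ioi (0:ℝ), Real.exp (-y * Real.cosh t + a * t)

/-- The trigonometric integral `∫_0^π e^{y·cos θ}·cos(aθ) dθ`. -/
noncomputable def expCosIntegral (a y : ℝ) : ℝ :=
  ∫ θ in (0:ℝ)..Real.pi, Real.exp (y * Real.cos θ) * Real.cos (a * θ)

lemma one_add_sq_div_two_le_cosh {t : ℝ} (ht : 0 ≤ t) : 1 + t ^ 2 / 2 ≤ Real.cosh t := by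
  have h1 : t / 2 ≤ Real.sinh (t / 2) := Real.self_le_sinh_iff.2 (by positivity)
  have h2 : Real.cosh t = 1 + 2 * Real.sinh (t / 2) ^ 2 := by
    have h := Real.cosh_two_mul (t / 2)
    rw [Real.cosh_sq, show 2 * (t / 2) = t by ring] at h
    linarith
  nlinarith [mul_self_le_mul_self (by positivity : (0:ℝ) ≤ t / 2) h1]

lemma exp_neg_mul_cosh_add_le {a y t : ℝ} (hy : 0 < y) (ht : 0 ≤ t) :
    Real.exp (-y * Real.cosh t + a * t) ≤
      Real.exp (-y + a ^ 2 / y) * Real.exp (-(y / 4) * t ^ 2) := by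
  rw [← Real.exp_add, Real.exp_le_exp]
  have h := mul_le_mul_of_nonneg_left (one_add_sq_div_two_le_cosh ht) hy.le
  have h2 : a * t ≤ a ^ 2 / y + y / 4 * t ^ 2 := by
    have h3 : a ^ 2 / y + y / 4 * t ^ 2 - a * t = (a - y * t / 2) ^ 2 / y := by
      field_simp
      ring
    have h4 : 0 ≤ (a - y * t / 2) ^ 2 / y := by positivity
    linarith
  linarith

lemma integrableOn_coshExp (a : ℝ) {y : ℝ} (hy : 0 < y) :
    IntegrableOn (fun t => Real.exp (-y * Real.cosh t + a * t)) (Ioi 0) := by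
  refine Integrable.mono' (((integrable_exp_neg_mul_sq (b := y / 4) (by positivity)).const_mul
    (Real.exp (-y + a ^ 2 / y))).integrableOn) (Continuous.aestronglyMeasurable (by fun_prop)) ?_
  filter_upwards [self_mem_ae_restrict measurableSet_Ioi] with t ht
  rw [Real.norm_eq_abs, Real.abs_exp]
  exact exp_neg_mul_cosh_add_le hy (le_of_lt ht)

lemma coshExpIntegral_le (a : ℝ) {y : ℝ} (hy : 0 < y) :
    coshExpIntegral a y ≤ Real.exp (-y + a ^ 2 / y) * (√(Real.pi / (y / 4)) / 2) := by
  rw [← integral_gaussian_Ioi, ← integral_const_mul]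
  refine setIntegral_mono_on (integrableOn_coshExp a hy)
    (((integrable_exp_neg_mul_sq (b := y / 4) (by positivity)).const_mul _).integrableOn)
    measurableSet_Ioi fun t ht => exp_neg_mul_cosh_add_le hy (le_of_lt ht)

lemma coshExpIntegral_le_of_abs_le_one {a y : ℝ} (ha : |a| ≤ 1) (hy : 1 ≤ y) :
    coshExpIntegral a y ≤ Real.exp 1 * √Real.pi * (Real.exp (-y) / √y) := by
  have hy0 : 0 < y := by linarith
  refine (coshExpIntegral_le a hy0).trans ?_
  have h1 : a ^ 2 / y ≤ 1 := by
    rw [div_le_one hy0]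
    have := (sq_le_one_iff_abs_le_one a).2 ha
    linarith
  have h2 : √(Real.pi / (y / 4)) / 2 = √Real.pi / √y := by
    rw [show Real.pi / (y / 4) = 2 ^ 2 * (Real.pi / y) by field_simp; norm_num,
      Real.sqrt_mul (by positivity), Real.sqrt_sq (by norm_num), Real.sqrt_div Real.pi_pos.le]
    ring
  rw [h2]
  calc Real.exp (-y + a ^ 2 / y) * (√Real.pi / √y)
      ≤ Real.exp (-y + 1) * (√Real.pi / √y) := by gcongr
    _ = Real.exp 1 * √Real.pi * (Real.exp (-y) / √y) := by
      rw [Real.exp_add]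
      ring

lemma le_coshExpIntegral {a y : ℝ} (ha : |a| ≤ 1) (hy : 1 ≤ y) :
    Real.exp (-2) * (Real.exp (-y) / √y) ≤ coshExpIntegral a y := by
  have hy0 : 0 < y := by linarith
  have hs : 0 < √y := Real.sqrt_pos.2 hy0
  have hs1 : 1 / √y ≤ 1 := by
    rw [div_le_one hs]
    exact Real.one_le_sqrt.2 hy
  have h1 : ∫ t in Ioc (0:ℝ) (1 / √y), Real.exp (-y - 2) ≤
      ∫ t in Ioc (0:ℝ) (1 / √y), Real.exp (-y * Real.cosh t + a * t) := by
    refine setIntegral_mono_on (by simp) ((integrableOn_coshExp a hy0).mono_set fun t ht => ht.1)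
      measurableSet_Ioc fun t ht => ?_
    rw [Real.exp_le_exp]
    have ht1 : t ≤ 1 := ht.2.trans hs1
    have ht2 : y * t ^ 2 ≤ 1 := by
      have h3 : t * √y ≤ 1 := (le_div_iff₀ hs).1 ht.2
      have h4 : 0 ≤ t * √y := mul_nonneg ht.1.le hs.le
      calc y * t ^ 2 = (t * √y) ^ 2 := by rw [mul_pow, Real.sq_sqrt hy0.le]; ring
        _ ≤ 1 := pow_le_one₀ h4 h3
    have ht3 : Real.cosh t ≤ 1 + t ^ 2 := by
      have h5 : t ^ 2 ≤ 1 := pow_le_one₀ ht.1.le ht1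
      have h6 := Real.abs_exp_sub_one_le (x := t ^ 2 / 2)
        (by rw [abs_of_nonneg (by positivity)]; linarith)
      rw [abs_of_nonneg (by positivity : (0:ℝ) ≤ t ^ 2 / 2)] at h6
      linarith [le_abs_self (Real.exp (t ^ 2 / 2) - 1), Real.cosh_le_exp_half_sq t]
    have ht4 : -1 ≤ a * t := by
      have := abs_le.1 ha
      nlinarith [ht.1]
    nlinarith [mul_le_mul_of_nonneg_left ht3 hy0.le]
  have h2 : ∫ t in Ioc (0:ℝ) (1 / √y), Real.exp (-y * Real.cosh t + a * t) ≤
      coshExpIntegral a y :=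
    setIntegral_mono_set (integrableOn_coshExp a hy0) (ae_of_all _ fun t => (Real.exp_pos _).le)
      (Eventually.of_forall fun t ht => ht.1)
  refine le_trans (le_of_eq ?_) (h1.trans h2)
  rw [setIntegral_const, Real.volume_real_Ioc_of_le (by positivity), smul_eq_mul, sub_zero,
    sub_eq_add_neg, Real.exp_add]
  ring

lemma cosh_mul_coshExp (a y t : ℝ) :
    Real.cosh t * Real.exp (-y * Real.cosh t + a * t) =
      (Real.exp (-y * Real.cosh t + (a + 1) * t) +
        Real.exp (-y * Real.cosh t + (a - 1) * t)) / 2 := by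
  rw [show -y * Real.cosh t + (a + 1) * t = -y * Real.cosh t + a * t + t by ring,
    show -y * Real.cosh t + (a - 1) * t = -y * Real.cosh t + a * t + -t by ring,
    Real.exp_add _ t, Real.exp_add _ (-t), Real.cosh_eq t]
  ring

lemma sinh_mul_coshExp (a y t : ℝ) :
    Real.sinh t * Real.exp (-y * Real.cosh t + a * t) =
      (Real.exp (-y * Real.cosh t + (a + 1) * t) -
        Real.exp (-y * Real.cosh t + (a - 1) * t)) / 2 := by
  rw [show -y * Real.cosh t + (a + 1) * t = -y * Real.cosh t + a * t + t by ring,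
    show -y * Real.cosh t + (a - 1) * t = -y * Real.cosh t + a * t + -t by ring,
    Real.exp_add _ t, Real.exp_add _ (-t), Real.sinh_eq t]
  ring

lemma hasDerivAt_coshExpIntegral (a : ℝ) {y : ℝ} (hy : 0 < y) :
    HasDerivAt (coshExpIntegral a)
      (-(coshExpIntegral (a + 1) y + coshExpIntegral (a - 1) y) / 2) y := by
  have hint : ∀ x : ℝ, 0 < x → IntegrableOn
      (fun t => Real.cosh t * Real.exp (-x * Real.cosh t + a * t)) (Ioi 0) := fun x hx => by
    simp_rw [cosh_mul_coshExp]
    exact ((integrableOn_coshExp _ hx).add (integrableOn_coshExp _ hx)).div_const 2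
  have h := (hasDerivAt_integral_of_dominated_loc_of_deriv_le (𝕜 := ℝ)
    (μ := volume.restrict (Ioi (0:ℝ)))
    (F := fun x t => Real.exp (-x * Real.cosh t + a * t))
    (F' := fun x t => -(Real.cosh t * Real.exp (-x * Real.cosh t + a * t)))
    (bound := fun t => Real.cosh t * Real.exp (-(y / 2) * Real.cosh t + a * t))
    (Ioi_mem_nhds (by linarith : y / 2 < y))
    (Eventually.of_forall fun x => Continuous.aestronglyMeasurable (by fun_prop))
    (integrableOn_coshExp a hy) (Continuous.aestronglyMeasurable (by fun_prop))
    (ae_of_all _ fun t x hx => ?_) (hint _ (by positivity))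
    (ae_of_all _ fun t x _ => ?_)).2
  · refine h.congr_deriv ?_
    rw [integral_neg]
    simp_rw [cosh_mul_coshExp]
    rw [integral_div, integral_add (integrableOn_coshExp _ hy) (integrableOn_coshExp _ hy)]
    simp only [coshExpIntegral]
    ring
  · have hc := Real.cosh_pos t
    rw [norm_neg, Real.norm_eq_abs, abs_of_nonneg (by positivity)]
    have hx' : y / 2 < x := hx
    gcongr
  · have h1 : HasDerivAt (fun x : ℝ => -x * Real.cosh t + a * t) (-1 * Real.cosh t) x :=
      (((hasDerivAt_id x).neg).mul_const (Real.cosh t)).add_const (a * t)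
    refine h1.exp.congr_deriv ?_
    ring

lemma mul_coshExpIntegral (a : ℝ) {y : ℝ} (hy : 0 < y) :
    a * coshExpIntegral a y =
      y / 2 * (coshExpIntegral (a + 1) y - coshExpIntegral (a - 1) y) - Real.exp (-y) := by
  have hE : ∀ t, (-y * Real.sinh t + a) * Real.exp (-y * Real.cosh t + a * t) =
      a * Real.exp (-y * Real.cosh t + a * t) -
        y / 2 * (Real.exp (-y * Real.cosh t + (a + 1) * t) -
          Real.exp (-y * Real.cosh t + (a - 1) * t)) := fun t => by
    linear_combination (-y) * sinh_mul_coshExp a y t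
  have hi := integrableOn_coshExp a hy
  have hi1 := integrableOn_coshExp (a + 1) hy
  have hi2 := integrableOn_coshExp (a - 1) hy
  have hi3 : IntegrableOn (fun t => y / 2 * (Real.exp (-y * Real.cosh t + (a + 1) * t) -
      Real.exp (-y * Real.cosh t + (a - 1) * t))) (Ioi 0) := (hi1.sub hi2).const_mul _
  have hlim : Tendsto (fun t => Real.exp (-y * Real.cosh t + a * t)) atTop (𝓝 0) := by
    have h1 : Tendsto (fun t : ℝ => -(y / 4) * t ^ 2) atTop atBot :=
      (tendsto_pow_atTop two_ne_zero).const_mul_atTop_of_neg (by linarith)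
    have h2 := (Real.tendsto_exp_atBot.comp h1).const_mul (Real.exp (-y + a ^ 2 / y))
    rw [mul_zero] at h2
    refine squeeze_zero' (Eventually.of_forall fun t => (Real.exp_pos _).le) ?_ h2
    filter_upwards [eventually_ge_atTop 0] with t ht
    exact exp_neg_mul_cosh_add_le hy ht
  have h := integral_Ioi_of_hasDerivAt_of_tendsto' (a := (0:ℝ))
    (f := fun t => Real.exp (-y * Real.cosh t + a * t))
    (f' := fun t => (-y * Real.sinh t + a) * Real.exp (-y * Real.cosh t + a * t))
    (fun t _ => by
      have h1 : HasDerivAt (fun t : ℝ => -y * Real.cosh t + a * t)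
          (-y * Real.sinh t + a * 1) t :=
        ((Real.hasDerivAt_cosh t).const_mul (-y)).add ((hasDerivAt_id t).const_mul a)
      refine h1.exp.congr_deriv ?_
      ring)
    (by
      simp_rw [hE]
      exact (hi.const_mul a).sub hi3)
    hlim
  simp_rw [hE] at h
  rw [integral_sub (hi.const_mul a) hi3, integral_const_mul, integral_const_mul,
    integral_sub hi1 hi2] at h
  simp only [Real.cosh_zero, mul_one, mul_zero, add_zero, zero_sub] at h
  simp only [coshExpIntegral]
  linarith

lemma besselK_eq (ν : ℝ) {y : ℝ} (hy : 0 < y) :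
    besselK ν y = (coshExpIntegral ν y + coshExpIntegral (-ν) y) / 2 := by
  simp only [besselK, coshExpIntegral]
  rw [← integral_add (integrableOn_coshExp _ hy) (integrableOn_coshExp _ hy), ← integral_div]
  congr 1 with t
  rw [Real.exp_add, Real.exp_add, Real.cosh_eq (ν * t), neg_mul ν t]
  ring

lemma besselI_eq (ν y : ℝ) :
    besselI ν y = 1 / Real.pi * expCosIntegral ν y -
      Real.sin (ν * Real.pi) / Real.pi * coshExpIntegral (-ν) y := by
  simp only [besselI, coshExpIntegral, expCosIntegral, neg_mul ν, ← sub_eq_add_neg]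
  rw [intervalIntegral.integral_sub (Continuous.intervalIntegrable (by fun_prop) _ _)
    intervalIntegrable_const, intervalIntegral.integral_const, smul_eq_mul, sub_zero]
  have hpi := Real.pi_ne_zero
  field_simp

lemma exists_hasDerivAt_besselK (ν : ℝ) {y : ℝ} (hy : 0 < y) :
    ∃ d, HasDerivAt (besselK ν) d y ∧ ν * besselK ν y + y * d =
      -(y / 2) * (coshExpIntegral (1 - ν) y + coshExpIntegral (ν - 1) y) := by
  refine ⟨_, (((hasDerivAt_coshExpIntegral ν hy).add
    (hasDerivAt_coshExpIntegral (-ν) hy)).div_const 2).congr_of_eventuallyEq ?_, ?_⟩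
  · filter_upwards [lt_mem_nhds hy] with x hx
    exact besselK_eq ν hx
  · have h1 := mul_coshExpIntegral ν hy
    have h2 := mul_coshExpIntegral (-ν) hy
    rw [besselK_eq ν hy]
    rw [show -ν + 1 = 1 - ν by ring] at *
    linear_combination h1 / 2 - h2 / 2

lemma hasDerivAt_expCosIntegral (a y : ℝ) :
    HasDerivAt (expCosIntegral a)
      (∫ θ in (0:ℝ)..Real.pi, Real.cos θ * (Real.exp (y * Real.cos θ) * Real.cos (a * θ))) y := by
  refine (intervalIntegral.hasDerivAt_integral_of_dominated_loc_of_deriv_le (𝕜 := ℝ)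
    (F := fun x θ => Real.exp (x * Real.cos θ) * Real.cos (a * θ))
    (F' := fun x θ => Real.cos θ * (Real.exp (x * Real.cos θ) * Real.cos (a * θ)))
    (bound := fun _ => Real.exp (|y| + 1))
    (Metric.ball_mem_nhds y one_pos)
    (Eventually.of_forall fun x => Continuous.aestronglyMeasurable (by fun_prop))
    (Continuous.intervalIntegrable (by fun_prop) _ _)
    (Continuous.aestronglyMeasurable (by fun_prop))
    (ae_of_all _ fun θ _ x hx => ?_) (by simp)
    (ae_of_all _ fun θ _ x _ => ?_)).2
  · rw [norm_mul, norm_mul, Real.norm_eq_abs, Real.norm_eq_abs, Real.norm_eq_abs, Real.abs_exp]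
    have h1 := Real.abs_cos_le_one θ
    have h2 := Real.abs_cos_le_one (a * θ)
    have h3 : x * Real.cos θ ≤ |y| + 1 := by
      have h4 : |x| ≤ |y| + 1 := by
        have h5 : |x - y| < 1 := by simpa [Real.dist_eq] using hx
        linarith [abs_sub_abs_le_abs_sub x y]
      calc x * Real.cos θ ≤ |x * Real.cos θ| := le_abs_self _
        _ = |x| * |Real.cos θ| := abs_mul _ _
        _ ≤ |x| * 1 := by gcongr
        _ ≤ |y| + 1 := by linarith
    calc |Real.cos θ| * (Real.exp (x * Real.cos θ) * |Real.cos (a * θ)|)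
        ≤ 1 * (Real.exp (|y| + 1) * 1) := by gcongr
      _ = Real.exp (|y| + 1) := by ring
  · have h1 : HasDerivAt (fun x : ℝ => x * Real.cos θ) (1 * Real.cos θ) x :=
      (hasDerivAt_id x).mul_const _
    refine (h1.exp.mul_const (Real.cos (a * θ))).congr_deriv ?_
    ring

lemma integral_exp_cos_by_parts (ν y : ℝ) :
    ν * expCosIntegral ν y + y * (∫ θ in (0:ℝ)..Real.pi,
      Real.cos θ * (Real.exp (y * Real.cos θ) * Real.cos (ν * θ))) =
      y * expCosIntegral (1 - ν) y + Real.exp (-y) * Real.sin (ν * Real.pi) := by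
  have h : ∫ θ in (0:ℝ)..Real.pi, (ν * (Real.exp (y * Real.cos θ) * Real.cos (ν * θ)) +
      y * (Real.cos θ * (Real.exp (y * Real.cos θ) * Real.cos (ν * θ))) -
      y * (Real.exp (y * Real.cos θ) * Real.cos ((1 - ν) * θ))) =
      Real.exp (y * Real.cos Real.pi) * Real.sin (ν * Real.pi) -
        Real.exp (y * Real.cos 0) * Real.sin (ν * 0) := by
    refine intervalIntegral.integral_eq_sub_of_hasDerivAt
      (f := fun θ => Real.exp (y * Real.cos θ) * Real.sin (ν * θ)) (fun θ _ => ?_)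
      (Continuous.intervalIntegrable (by fun_prop) _ _)
    have h1 : HasDerivAt (fun θ : ℝ => y * Real.cos θ) (y * -Real.sin θ) θ :=
      (Real.hasDerivAt_cos θ).const_mul y
    have h2 : HasDerivAt (fun θ : ℝ => ν * θ) (ν * 1) θ := (hasDerivAt_id θ).const_mul ν
    refine (h1.exp.mul h2.sin).congr_deriv ?_
    rw [show (1 - ν) * θ = θ - ν * θ by ring, Real.cos_sub]
    ring
  rw [intervalIntegral.integral_sub (Continuous.intervalIntegrable (by fun_prop) _ _)
    (Continuous.intervalIntegrable (by fun_prop) _ _),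
    intervalIntegral.integral_add (Continuous.intervalIntegrable (by fun_prop) _ _)
    (Continuous.intervalIntegrable (by fun_prop) _ _), intervalIntegral.integral_const_mul,
    intervalIntegral.integral_const_mul, intervalIntegral.integral_const_mul] at h
  simp only [Real.cos_pi, mul_neg, mul_one, mul_zero, Real.sin_zero, sub_zero] at h
  simp only [expCosIntegral]
  linarith

lemma exists_hasDerivAt_besselI (ν : ℝ) {y : ℝ} (hy : 0 < y) :
    ∃ d, HasDerivAt (besselI ν) d y ∧ ν * besselI ν y + y * d =
      y * (1 / Real.pi * expCosIntegral (1 - ν) y +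
        Real.sin (ν * Real.pi) / Real.pi * coshExpIntegral (1 - ν) y) := by
  refine ⟨_, (((hasDerivAt_expCosIntegral ν y).const_mul (1 / Real.pi)).sub
    ((hasDerivAt_coshExpIntegral (-ν) hy).const_mul
      (Real.sin (ν * Real.pi) / Real.pi))).congr_of_eventuallyEq
      (Eventually.of_forall fun x => besselI_eq ν x), ?_⟩
  have h1 := integral_exp_cos_by_parts ν y
  have h2 := mul_coshExpIntegral (-ν) hy
  rw [besselI_eq]
  rw [show -ν + 1 = 1 - ν by ring] at *
  linear_combination (1 / Real.pi) * h1 + (Real.sin (ν * Real.pi) / Real.pi) * h2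

lemma expCosIntegral_le (a : ℝ) {y : ℝ} (hy : 0 < y) :
    expCosIntegral a y ≤ Real.pi * √Real.pi * (Real.exp y / √y) := by
  have hp := Real.pi_pos
  set b : ℝ := y * (2 / Real.pi ^ 2) with hb
  have hb0 : 0 < b := by positivity
  have hi := (integrable_exp_neg_mul_sq hb0).const_mul (Real.exp y)
  have h1 : expCosIntegral a y ≤ ∫ θ in (0:ℝ)..Real.pi,
      Real.exp y * Real.exp (-b * θ ^ 2) := by
    refine intervalIntegral.integral_mono_on hp.le
      (Continuous.intervalIntegrable (by fun_prop) _ _)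
      (Continuous.intervalIntegrable (by fun_prop) _ _) fun θ hθ => ?_
    have h2 := Real.cos_le_one_sub_mul_cos_sq (x := θ) (by rw [abs_of_nonneg hθ.1]; exact hθ.2)
    calc Real.exp (y * Real.cos θ) * Real.cos (a * θ)
        ≤ Real.exp (y * Real.cos θ) * 1 := by
          gcongr
          exact Real.cos_le_one _
      _ = Real.exp (y * Real.cos θ) := mul_one _
      _ ≤ Real.exp y * Real.exp (-b * θ ^ 2) := by
        rw [← Real.exp_add, Real.exp_le_exp]
        nlinarith [mul_le_mul_of_nonneg_left h2 hy.le]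
  have h3 : ∫ θ in (0:ℝ)..Real.pi, Real.exp y * Real.exp (-b * θ ^ 2) ≤
      ∫ θ in Ioi (0:ℝ), Real.exp y * Real.exp (-b * θ ^ 2) := by
    rw [intervalIntegral.integral_of_le hp.le]
    exact setIntegral_mono_set hi.integrableOn (ae_of_all _ fun θ => by positivity)
      (Eventually.of_forall fun θ hθ => hθ.1)
  refine (h1.trans h3).trans ?_
  rw [integral_const_mul, integral_gaussian_Ioi]
  have h4 : √(Real.pi / b) / 2 ≤ Real.pi * √Real.pi / √y := by
    have h5 : √(Real.pi / b) ≤ √(Real.pi ^ 2 * (Real.pi / y)) := by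
      apply Real.sqrt_le_sqrt
      rw [hb, show Real.pi / (y * (2 / Real.pi ^ 2)) = Real.pi ^ 2 * (Real.pi / y) / 2 by
        field_simp]
      have : 0 < Real.pi ^ 2 * (Real.pi / y) := by positivity
      linarith
    rw [Real.sqrt_mul (by positivity), Real.sqrt_sq hp.le, Real.sqrt_div hp.le y,
      ← mul_div_assoc] at h5
    have : 0 ≤ √(Real.pi / b) := Real.sqrt_nonneg _
    linarith
  calc Real.exp y * (√(Real.pi / b) / 2) ≤ Real.exp y * (Real.pi * √Real.pi / √y) := by gcongr
    _ = _ := by ring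

lemma integral_exp_cos_mul_cos (y : ℝ) :
    expCosIntegral 1 y =
      ∫ θ in (0:ℝ)..Real.pi, y * (Real.exp (y * Real.cos θ) * Real.sin θ ^ 2) := by
  have h : ∫ θ in (0:ℝ)..Real.pi, (Real.exp (y * Real.cos θ) * Real.cos (1 * θ) -
      y * (Real.exp (y * Real.cos θ) * Real.sin θ ^ 2)) =
      Real.exp (y * Real.cos Real.pi) * Real.sin Real.pi -
        Real.exp (y * Real.cos 0) * Real.sin 0 := by
    refine intervalIntegral.integral_eq_sub_of_hasDerivAt
      (f := fun θ => Real.exp (y * Real.cos θ) * Real.sin θ) (fun θ _ => ?_)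
      (Continuous.intervalIntegrable (by fun_prop) _ _)
    refine ((((Real.hasDerivAt_cos θ).const_mul y).exp).mul
      (Real.hasDerivAt_sin θ)).congr_deriv ?_
    rw [one_mul]
    ring
  rw [intervalIntegral.integral_sub (Continuous.intervalIntegrable (by fun_prop) _ _)
    (Continuous.intervalIntegrable (by fun_prop) _ _)] at h
  simp only [Real.sin_pi, Real.sin_zero, mul_zero, sub_zero] at h
  simp only [expCosIntegral]
  linarith

lemma le_expCosIntegral_one {y : ℝ} (hy : 1 ≤ y) :
    Real.exp (-1) * (2 / Real.pi) ^ 2 / 3 * (Real.exp y / √y) ≤ expCosIntegral 1 y := by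
  have hp := Real.pi_gt_three
  have hy0 : 0 < y := by linarith
  have hs : 0 < √y := Real.sqrt_pos.2 hy0
  have hs1 : 1 / √y ≤ 1 := by
    rw [div_le_one hs]
    exact Real.one_le_sqrt.2 hy
  have h1 : ∫ θ in (0:ℝ)..(1 / √y), y * Real.exp (y - 1) * (2 / Real.pi) ^ 2 * θ ^ 2 ≤
      ∫ θ in (0:ℝ)..(1 / √y), y * (Real.exp (y * Real.cos θ) * Real.sin θ ^ 2) := by
    refine intervalIntegral.integral_mono_on (by positivity)
      (Continuous.intervalIntegrable (by fun_prop) _ _)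
      (Continuous.intervalIntegrable (by fun_prop) _ _) fun θ hθ => ?_
    have hθ0 : 0 ≤ θ := hθ.1
    have hθ2 : y * θ ^ 2 ≤ 1 := by
      have h3 : θ * √y ≤ 1 := (le_div_iff₀ hs).1 hθ.2
      have h4 : 0 ≤ θ * √y := mul_nonneg hθ.1 hs.le
      calc y * θ ^ 2 = (θ * √y) ^ 2 := by rw [mul_pow, Real.sq_sqrt hy0.le]; ring
        _ ≤ 1 := pow_le_one₀ h4 h3
    have hsin := Real.mul_le_sin hθ0 (by linarith [hθ.2])
    have hcos : y - 1 ≤ y * Real.cos θ := by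
      nlinarith [mul_le_mul_of_nonneg_left (Real.one_sub_sq_div_two_le_cos (x := θ)) hy0.le]
    calc y * Real.exp (y - 1) * (2 / Real.pi) ^ 2 * θ ^ 2
        = y * (Real.exp (y - 1) * (2 / Real.pi * θ) ^ 2) := by ring
      _ ≤ y * (Real.exp (y * Real.cos θ) * Real.sin θ ^ 2) := by gcongr
  have h2 : ∫ θ in (0:ℝ)..(1 / √y), y * (Real.exp (y * Real.cos θ) * Real.sin θ ^ 2) ≤
      expCosIntegral 1 y := by
    rw [integral_exp_cos_mul_cos]
    exact intervalIntegral.integral_mono_interval le_rfl (by positivity) (by linarith)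
      (ae_of_all _ fun θ => by positivity) (Continuous.intervalIntegrable (by fun_prop) _ _)
  refine le_trans (le_of_eq ?_) (h1.trans h2)
  rw [intervalIntegral.integral_const_mul, integral_pow, sub_eq_add_neg, Real.exp_add]
  have hsq : √y ^ 2 = y := Real.sq_sqrt hy0.le
  have hcube : (1 / √y) ^ 3 = 1 / (y * √y) := by
    rw [one_div_pow, pow_succ, hsq]
  norm_num [hcube]
  field_simp
  exact hsq

lemma le_expCosIntegral {a y : ℝ} (ha0 : 0 ≤ a) (ha : a ≤ 1) (hy : 1 ≤ y) :
    Real.exp (-1) * (2 / Real.pi) ^ 2 / 3 * (Real.exp y / √y) ≤ expCosIntegral a y := by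
  refine (le_expCosIntegral_one hy).trans ?_
  refine intervalIntegral.integral_mono_on Real.pi_pos.le
    (Continuous.intervalIntegrable (by fun_prop) _ _)
    (Continuous.intervalIntegrable (by fun_prop) _ _) fun θ hθ => ?_
  have hθ0 : 0 ≤ θ := hθ.1
  gcongr
  exact Real.cos_le_cos_of_nonneg_of_le_pi (by positivity) (by linarith [hθ.2]) (by gcongr)

/-- Chain rule for `√z · B(μ z^p)` when `B` satisfies a first-order Bessel recurrence of
index `1 / (2p)`. -/
lemma deriv_sqrt_mul_comp {B : ℝ → ℝ} {ν μ p z d r : ℝ} (hz : 0 < z) (hν : 2 * p * ν = 1)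
    (hB : HasDerivAt B d (μ * z ^ p)) (hr : ν * B (μ * z ^ p) + μ * z ^ p * d = r) :
    deriv (fun x => √x * B (μ * x ^ p)) z = p * r / √z := by
  have h1 : HasDerivAt (fun x : ℝ => μ * x ^ p) (μ * (p * z ^ (p - 1))) z :=
    (Real.hasDerivAt_rpow_const (Or.inl hz.ne')).const_mul μ
  have h2 := (Real.hasDerivAt_sqrt hz.ne').mul (hB.comp z h1)
  have h3 := h2.deriv
  have hs : 0 < √z := Real.sqrt_pos.2 hz
  have hsq : √z ^ 2 = z := Real.sq_sqrt hz.le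
  refine Eq.trans h3 ?_
  simp only [Function.comp]
  rw [Real.rpow_sub_one hz.ne', ← hr]
  field_simp
  rw [hsq]
  field_simp
  linear_combination (-B (μ * z ^ p)) * hν

lemma scaled_argument (n : ℕ) (hn : 3 ≤ n) {lam z : ℝ} (hlam : 0 < lam) (hz : 0 < z) :
    √(2 * √(lam / n) * z ^ ((n : ℝ) / 2)) / √z =
      √(2 / √n) * (lam ^ ((1 : ℝ) / 4) * z ^ (((n : ℝ) - 2) / 4)) := by
  have hn0 : (0:ℝ) < n := by positivity
  have h1 : √(√lam) = lam ^ ((1:ℝ) / 4) := by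
    rw [Real.sqrt_eq_rpow, Real.sqrt_eq_rpow, ← Real.rpow_mul hlam.le]
    norm_num
  have h2 : √(z ^ ((n:ℝ) / 2)) / √z = z ^ (((n:ℝ) - 2) / 4) := by
    rw [Real.sqrt_eq_rpow, Real.sqrt_eq_rpow, ← Real.rpow_mul hz.le, ← Real.rpow_sub hz]
    congr 1
    ring
  rw [← h1, ← h2, Real.sqrt_div hlam.le,
    show 2 * (√lam / √n) * z ^ ((n : ℝ) / 2) = 2 / √n * (√lam * z ^ ((n : ℝ) / 2)) by ring,
    Real.sqrt_mul (by positivity), Real.sqrt_mul (by positivity)]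
  ring

lemma one_lt_argument (n : ℕ) (hn : 3 ≤ n) {lam1 lam z : ℝ} (hlam1 : 0 < lam1)
    (hlam : lam1 ≤ lam) (hz : ((n : ℝ) / (4 * lam1)) ^ (1 / (n : ℝ)) < z) :
    1 < 2 * √(lam / n) * z ^ ((n : ℝ) / 2) := by
  have hn0 : (0:ℝ) < n := by positivity
  have hlam0 : 0 < lam := hlam1.trans_le hlam
  have hz0 : 0 < z := lt_of_le_of_lt (by positivity) hz
  have h1 : (n : ℝ) / (4 * lam1) < z ^ (n : ℝ) := by
    have h := Real.rpow_lt_rpow (by positivity) hz hn0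
    rwa [← Real.rpow_mul (by positivity), one_div_mul_cancel hn0.ne', Real.rpow_one] at h
  have h2 : (2 * √(lam / n) * z ^ ((n : ℝ) / 2)) ^ 2 = 4 * (lam / n) * z ^ (n : ℝ) := by
    rw [mul_pow, mul_pow, Real.sq_sqrt (by positivity), ← Real.rpow_natCast (z ^ _),
      ← Real.rpow_mul hz0.le]
    norm_num
  have h3 : 1 < (2 * √(lam / n) * z ^ ((n : ℝ) / 2)) ^ 2 := by
    rw [h2]
    calc (1:ℝ) = 4 * (lam1 / n) * (n / (4 * lam1)) := by field_simp
      _ < 4 * (lam1 / n) * z ^ (n : ℝ) := by gcongr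
      _ ≤ 4 * (lam / n) * z ^ (n : ℝ) := by gcongr
  exact (one_lt_sq_iff₀ (by positivity)).1 h3

lemma inv_mul_lt_and_lt_mul {k c₁ c₂ C X x : ℝ} (hX : 0 < X) (hk : 0 < k) (hc₁ : 0 < c₁)
    (hC₁ : (k * c₁)⁻¹ < C) (hC₂ : k * c₂ < C) (h₁ : k * (c₁ * X) ≤ x) (h₂ : x ≤ k * (c₂ * X)) :
    C⁻¹ * X < x ∧ x < C * X := by
  refine ⟨lt_of_lt_of_le ?_ h₁, lt_of_le_of_lt h₂ ?_⟩
  · rw [← mul_assoc]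
    exact mul_lt_mul_of_pos_right (inv_lt_of_inv_lt₀ (by positivity) hC₁) hX
  · rw [← mul_assoc]
    exact mul_lt_mul_of_pos_right hC₂ hX

/-- For an integer `n ≥ 3` there is a constant `C > 1` depending only on `n` such that for
every `λ₁ > 0`, every `λ ≥ λ₁` and every `z > (n/(4λ₁))^{1/n}`:
`C⁻¹·λ^{1/4} z^{(n−2)/4} e^{−(2/√n)√λ z^{n/2}} < −D'(z) < C·λ^{1/4} z^{(n−2)/4} e^{−(2/√n)√λ z^{n/2}}`
and `C⁻¹·λ^{1/4} z^{(n−2)/4} e^{(2/√n)√λ z^{n/2}} < G'(z) < C·λ^{1/4} z^{(n−2)/4} e^{(2/√n)√λ z^{n/2}}`. -/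
theorem deriv_calD_calG_bounds (n : ℕ) (hn : 3 ≤ n) :
    ∃ C : ℝ, 1 < C ∧ ∀ lam1 : ℝ, 0 < lam1 → ∀ lam : ℝ, lam1 ≤ lam →
      ∀ z : ℝ, ((n : ℝ) / (4 * lam1)) ^ (1 / (n : ℝ)) < z →
        (C⁻¹ * (lam ^ ((1 : ℝ) / 4) * z ^ (((n : ℝ) - 2) / 4) *
            Real.exp (-(2 / Real.sqrt n) * Real.sqrt lam * z ^ ((n : ℝ) / 2)))
              < -deriv (calD n lam) z ∧
          -deriv (calD n lam) z < C * (lam ^ ((1 : ℝ) / 4) * z ^ (((n : ℝ) - 2) / 4) *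
            Real.exp (-(2 / Real.sqrt n) * Real.sqrt lam * z ^ ((n : ℝ) / 2)))) ∧
        (C⁻¹ * (lam ^ ((1 : ℝ) / 4) * z ^ (((n : ℝ) - 2) / 4) *
            Real.exp ((2 / Real.sqrt n) * Real.sqrt lam * z ^ ((n : ℝ) / 2)))
              < deriv (calG n lam) z ∧
          deriv (calG n lam) z < C * (lam ^ ((1 : ℝ) / 4) * z ^ (((n : ℝ) - 2) / 4) *
            Real.exp ((2 / Real.sqrt n) * Real.sqrt lam * z ^ ((n : ℝ) / 2)))) := by
  have hn0 : (0:ℝ) < n := by positivity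
  have hn1 : (3:ℝ) ≤ n := by exact_mod_cast hn
  set ν : ℝ := 1 / (n:ℝ) with hν
  have hν0 : 0 < ν := by positivity
  have hν1 : ν ≤ 1 := by
    rw [hν, div_le_one hn0]
    linarith
  have hpi := Real.pi_pos
  have hsin : 0 ≤ Real.sin (ν * Real.pi) :=
    Real.sin_nonneg_of_nonneg_of_le_pi (by positivity) (mul_le_of_le_one_left hpi.le hν1)
  set k : ℝ := n / 2 * √(2 / √n) with hk
  have hk0 : 0 < k := by positivity
  set a₁ : ℝ := Real.exp (-2) with ha₁
  set a₂ : ℝ := Real.exp 1 * √Real.pi with ha₂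
  set b₁ : ℝ := 1 / Real.pi * (Real.exp (-1) * (2 / Real.pi) ^ 2 / 3) with hb₁
  set b₂ : ℝ := 1 / Real.pi * (Real.pi * √Real.pi) + 1 / Real.pi * a₂ with hb₂
  have ha₁0 : 0 < a₁ := by positivity
  have ha₂0 : 0 < a₂ := by positivity
  have hb₁0 : 0 < b₁ := by positivity
  have hb₂0 : 0 < b₂ := by positivity
  have q1 : 0 < (k * a₁)⁻¹ := by positivity
  have q2 : 0 < (k * b₁)⁻¹ := by positivity
  have q3 : 0 < k * a₂ := by positivity
  have q4 : 0 < k * b₂ := by positivity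
  refine ⟨1 + (k * a₁)⁻¹ + (k * b₁)⁻¹ + k * a₂ + k * b₂, by linarith, ?_⟩
  intro lam1 hlam1 lam hlam z hz
  have hz0 : 0 < z := lt_of_le_of_lt (by positivity) hz
  have hlam0 : 0 < lam := hlam1.trans_le hlam
  have hy1 := one_lt_argument n hn hlam1 hlam hz
  have hM := scaled_argument n hn hlam0 hz0
  have hexp : 2 / √n * √lam * z ^ ((n:ℝ) / 2) = 2 * √(lam / n) * z ^ ((n : ℝ) / 2) := by
    rw [Real.sqrt_div hlam0.le]
    ring
  rw [neg_mul, neg_mul, hexp]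
  set y : ℝ := 2 * √(lam / n) * z ^ ((n : ℝ) / 2) with hy
  set M : ℝ := lam ^ ((1 : ℝ) / 4) * z ^ (((n : ℝ) - 2) / 4) with hMdef
  have hM0 : 0 < M := by positivity
  have hy0 : 0 < y := by linarith
  have hsy : 0 < √y := Real.sqrt_pos.2 hy0
  have hsz : 0 < √z := Real.sqrt_pos.2 hz0
  have hnν : 2 * ((n:ℝ) / 2) * ν = 1 := by rw [hν]; field_simp
  obtain ⟨d, hd, hdr⟩ := exists_hasDerivAt_besselK ν hy0
  obtain ⟨e, he, her⟩ := exists_hasDerivAt_besselI ν hy0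
  have hD : deriv (calD n lam) z = _ := deriv_sqrt_mul_comp hz0 hnν hd hdr
  have hG : deriv (calG n lam) z = _ := deriv_sqrt_mul_comp hz0 hnν he her
  have hkey : ∀ c E : ℝ, k * (c * (M * E)) = n / 2 * y / √z * (c * (E / √y)) := fun c E => by
    have h1 : y / √z = √y * (√(2 / √n) * M) := by
      rw [← hM, ← mul_div_assoc, Real.mul_self_sqrt hy0.le]
    rw [mul_div_assoc, h1, hk]
    field_simp
  have hw : 0 ≤ n / 2 * y / √z := by positivity
  have hab1 : |1 - ν| ≤ 1 := abs_le.2 ⟨by linarith, by linarith⟩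
  have hab2 : |ν - 1| ≤ 1 := abs_le.2 ⟨by linarith, by linarith⟩
  have u1 := le_coshExpIntegral hab1 hy1.le
  have u2 := le_coshExpIntegral hab2 hy1.le
  have v1 := coshExpIntegral_le_of_abs_le_one hab1 hy1.le
  have v2 := coshExpIntegral_le_of_abs_le_one hab2 hy1.le
  have s1 := le_expCosIntegral (by linarith : 0 ≤ 1 - ν) (by linarith) hy1.le
  have t1 := expCosIntegral_le (1 - ν) hy0
  constructor
  · refine inv_mul_lt_and_lt_mul (c₁ := a₁) (c₂ := a₂) (by positivity) hk0 ha₁0 (by linarith)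
      (by linarith) ?_ ?_
    · rw [hkey, hD]
      calc n / 2 * y / √z * (a₁ * (Real.exp (-y) / √y)) ≤ n / 2 * y / √z *
            ((coshExpIntegral (1 - ν) y + coshExpIntegral (ν - 1) y) / 2) := by
            gcongr
            linarith
        _ = _ := by ring
    · rw [hkey, hD]
      calc _ = n / 2 * y / √z *
            ((coshExpIntegral (1 - ν) y + coshExpIntegral (ν - 1) y) / 2) := by ring
        _ ≤ n / 2 * y / √z * (a₂ * (Real.exp (-y) / √y)) := by
            gcongr
            linarith
  · have hE0 : 0 ≤ coshExpIntegral (1 - ν) y := le_trans (by positivity) u1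
    refine inv_mul_lt_and_lt_mul (c₁ := b₁) (c₂ := b₂) (by positivity) hk0 hb₁0 (by linarith)
      (by linarith) ?_ ?_
    · rw [hkey, hG]
      calc n / 2 * y / √z * (b₁ * (Real.exp y / √y)) ≤ n / 2 * y / √z *
            (1 / Real.pi * expCosIntegral (1 - ν) y +
              Real.sin (ν * Real.pi) / Real.pi * coshExpIntegral (1 - ν) y) := by
            gcongr
            have h1 : 0 ≤ Real.sin (ν * Real.pi) / Real.pi * coshExpIntegral (1 - ν) y := by
              positivity
            have h2 := mul_le_mul_of_nonneg_left s1 (by positivity : 0 ≤ 1 / Real.pi)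
            rw [hb₁]
            linarith
        _ = _ := by ring
    · rw [hkey, hG]
      calc _ = n / 2 * y / √z * (1 / Real.pi * expCosIntegral (1 - ν) y +
              Real.sin (ν * Real.pi) / Real.pi * coshExpIntegral (1 - ν) y) := by ring
        _ ≤ n / 2 * y / √z * (1 / Real.pi * (Real.pi * √Real.pi * (Real.exp y / √y)) +
              1 / Real.pi * (a₂ * (Real.exp y / √y))) := by
            have h3 : coshExpIntegral (1 - ν) y ≤ a₂ * (Real.exp y / √y) := by
              refine v1.trans ?_
              gcongr
              linarith
            gcongr
            exact Real.sin_le_one _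
        _ = n / 2 * y / √z * (b₂ * (Real.exp y / √y)) := by
            rw [hb₂]
            ring
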